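/- Let p > 2 be a prime and let a, b, a', b' be nonzero elements of ℤ_p ⊆ ℚ_p with a ≠ b and a' ≠ b'. Assume ν_p(a) = 0, ν_p(a−b) ≥ 1, ν_p(a') = 0 and ν_p(a'−b') ≥ 1 (i.e., a ≡ b ≢ 0 and a' ≡ b' ≢ 0 (mod p), so neither elliptic curve has potential good reduction), and assume every vector of 𝔽₂⁴ is a kernel vector of M_{aba'b'} (equivalently, all entries of M_{aba'b'} are squares in ℚ_p). Then on the set of points P = (x,u,z) ∈ ℚ_p³ with z ≠ 0 and z² = x(x−a)(x−b)·u(u−a')(u−b'): the maps ev_{e₁}, ev_{e₂}, ev_{e₃} are identically 0, while ev_{e₄} is non-constant, i.e., there exist two such points P, P' with ev_{e₄}(P) ≠ ev_{e₄}(P'). (Hence the subspace of 2-torsion Brauer classes with constant evaluation map has dimension exactly 3.) -/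

import Mathlib

/-- The Hilbert symbol `(A,B)_k` is trivial if `A·r² + B·s² = 1` is solvable. -/
def HilbertTrivial {k : Type*} [Field k] (A B : k) : Prop :=
  ∃ r s : k, A * r ^ 2 + B * s ^ 2 = 1

/-- The Skorobogatov–Zarhin matrix `M_{aba'b'}`. -/
def SZMatrix {k : Type*} [Field k] (a b a' b' : k) : Fin 4 → Fin 4 → k :=
  ![![1, a * b, a' * b', -(a * a')],
    ![a * b, 1, a * a', a' * (a' - b')],
    ![a' * b', a * a', 1, a * (a - b)],
    ![-(a * a'), a' * (a' - b'), a * (a - b), 1]]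

/-- `ε ∈ 𝔽₂⁴` is a kernel vector of `M_{aba'b'}` if for every row `i` the product of
those entries `M i j` with `ε j = 1` is a square in `k`. -/
def IsKernelVector {k : Type*} [Field k] (a b a' b' : k) (ε : Fin 4 → ZMod 2) : Prop :=
  ∀ i : Fin 4,
    IsSquare (∏ j ∈ Finset.univ.filter (fun j : Fin 4 => ε j = 1), SZMatrix a b a' b' i j)

/-- The four pairs of rational functions defining the basis quaternion algebras,
evaluated at `(x, u)`. -/
def symPair {k : Type*} [Field k] (a b a' b' x u : k) : Fin 4 → k × k :=
  ![((x - a) * (x - b), (u - a') * (u - b')),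
    ((x - a) * (x - b), u * (u - b')),
    (x * (x - b), (u - a') * (u - b')),
    (x * (x - b), u * (u - b'))]

open Classical in
/-- The evaluation map `ev_ε` at the point with coordinates `(x, u)`:
the sum over those `i` with `ε i = 1` of `0` or `1` according to whether the
`i`-th Hilbert symbol is trivial or not. -/
noncomputable def evMap {k : Type*} [Field k] (a b a' b' : k) (ε : Fin 4 → ZMod 2)
    (x u : k) : ZMod 2 :=
  ∑ i ∈ Finset.univ.filter (fun i : Fin 4 => ε i = 1),
    (if HilbertTrivial (symPair a b a' b' x u i).1 (symPair a b a' b' x u i).2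
      then (0 : ZMod 2) else 1)

/-- The standard basis vectors of `𝔽₂⁴`. -/
def stdBasis (i : Fin 4) : Fin 4 → ZMod 2 := Pi.single i 1

open Polynomial in
theorem Padic.isSquare_one_add {p : ℕ} [Fact p.Prime] (hp : 2 < p) {t : ℚ_[p]}
    (ht : ‖t‖ < 1) : IsSquare (1 + t) := by
  have h2 : ‖(2 : ℤ_[p])‖ = 1 := by
    have : IsCoprime ((2 : ℕ) : ℤ) p := by
      rw [Nat.isCoprime_iff_coprime]
      exact (Nat.coprime_primes Nat.prime_two Fact.out).2 hp.ne
    have := PadicInt.norm_intCast_eq_one_iff (p := p) |>.2 this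
    simpa using this
  obtain ⟨t, rfl⟩ : ∃ x : ℤ_[p], (x : ℚ_[p]) = t := ⟨⟨t, ht.le⟩, rfl⟩
  obtain ⟨z, hz, -⟩ := hensels_lemma (p := p) (F := X ^ 2 - C (1 + t)) (a := (1 : ℤ_[p])) (by
    simpa [h2, one_add_one_eq_two] using ht)
  refine ⟨z, ?_⟩
  have hz' : z ^ 2 = 1 + t := by simpa [sub_eq_zero] using hz
  rw [← sq]
  rw [← PadicInt.coe_pow, hz', PadicInt.coe_add, PadicInt.coe_one]

theorem IsSquare.of_sq_mul {k : Type*} [Field k] {c A : k} (hc : c ≠ 0)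
    (h : IsSquare (c ^ 2 * A)) : IsSquare A := by
  have := h.div (IsSquare.sq c)
  rwa [mul_div_cancel_left₀ _ (pow_ne_zero 2 hc)] at this

theorem Padic.isSquare_mul_add {p : ℕ} [Fact p.Prime] (hp : 2 < p) {y t : ℚ_[p]}
    (h : ‖t‖ < ‖y‖) : IsSquare (y * (y + t)) := by
  have hy : y ≠ 0 := by
    rintro rfl
    exact absurd h (by simp)
  have hty : ‖t / y‖ < 1 := by
    rw [norm_div]
    exact (div_lt_one (norm_pos_iff.2 hy)).2 h
  have := (IsSquare.sq y).mul (Padic.isSquare_one_add hp hty)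
  have heq : y * (y + t) = y ^ 2 * (1 + t / y) := by field_simp
  rwa [heq]

theorem HilbertTrivial.symm {k : Type*} [Field k] {A B : k} (h : HilbertTrivial A B) :
    HilbertTrivial B A := by
  obtain ⟨r, s, h⟩ := h
  exact ⟨s, r, by rw [← h]; ring⟩

theorem hilbertTrivial_sq_mul_iff {k : Type*} [Field k] {A B c d : k} (hc : c ≠ 0) (hd : d ≠ 0) :
    HilbertTrivial (c ^ 2 * A) (d ^ 2 * B) ↔ HilbertTrivial A B := by
  constructor
  · rintro ⟨r, s, h⟩
    exact ⟨c * r, d * s, by rw [← h]; ring⟩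
  · rintro ⟨r, s, h⟩
    exact ⟨r / c, s / d, by rw [← h]; field_simp⟩

theorem hilbertTrivial_of_isSquare_left {k : Type*} [Field k] {A : k} (B : k) (hA : A ≠ 0)
    (h : IsSquare A) : HilbertTrivial A B := by
  obtain ⟨c, rfl⟩ := h
  have hc : c ≠ 0 := left_ne_zero_of_mul hA
  exact ⟨c⁻¹, 0, by field_simp; simp⟩

theorem hilbertTrivial_of_isSquare_mul {k : Type*} [Field k] (h2 : (2 : k) ≠ 0)
    (hneg : IsSquare (-1 : k)) {A B : k} (hA : A ≠ 0) (hB : B ≠ 0)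
    (h : IsSquare (A * B)) : HilbertTrivial A B := by
  obtain ⟨c, hc⟩ := h
  obtain ⟨i, hi⟩ := hneg
  have hi0 : i ≠ 0 := by rintro rfl; simp at hi
  have hc0 : c ≠ 0 := by rintro rfl; simp_all
  refine ⟨(A⁻¹ + 1) / 2, (A⁻¹ - 1) * A / (2 * i * c), ?_⟩
  have hB' : B = c * c / A := by rw [← hc]; field_simp
  have hi2 : i ^ 2 = -1 := by rw [hi]; ring
  rw [hB']
  field_simp
  rw [hi2]
  ring

theorem PadicInt.norm_lt_one_iff_toZMod_eq_zero {p : ℕ} [Fact p.Prime] {x : ℤ_[p]} :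
    ‖x‖ < 1 ↔ PadicInt.toZMod x = 0 := by
  rw [← RingHom.mem_ker, PadicInt.ker_toZMod, PadicInt.maximalIdeal_eq_span_p,
    Ideal.mem_span_singleton, PadicInt.norm_lt_one_iff_dvd]

open Polynomial in
theorem ZMod.exists_mul_sq_add_mul_sq {p : ℕ} [Fact p.Prime] (hp : 2 < p) {a b : ZMod p}
    (ha : a ≠ 0) (hb : b ≠ 0) : ∃ r s : ZMod p, a * r ^ 2 + b * s ^ 2 = 1 := by
  have hodd : p % 2 = 1 := (Fact.out : p.Prime).eq_two_or_odd.resolve_left hp.ne'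
  obtain ⟨r, s, h⟩ := FiniteField.exists_root_sum_quadratic (R := ZMod p)
    (f := C a * X ^ 2) (g := C b * X ^ 2 - C 1) (degree_C_mul_X_pow 2 ha)
    (by rw [degree_sub_C (by rw [degree_C_mul_X_pow 2 hb]; decide), degree_C_mul_X_pow 2 hb]; rfl)
    (by rw [ZMod.card, hodd])
  refine ⟨r, s, ?_⟩
  simp at h
  linear_combination h

theorem hilbertTrivial_of_toZMod {p : ℕ} [Fact p.Prime] (hp : 2 < p) {A B r s : ℤ_[p]}
    (hA : ‖A‖ = 1) (hr : ‖r‖ = 1)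
    (h : PadicInt.toZMod (A * r ^ 2 + B * s ^ 2 - 1) = 0) :
    HilbertTrivial (A : ℚ_[p]) (B : ℚ_[p]) := by
  rw [← PadicInt.norm_lt_one_iff_toZMod_eq_zero, PadicInt.norm_def] at h
  rw [PadicInt.norm_def] at hA hr
  push_cast at h
  have hA0 : (A : ℚ_[p]) ≠ 0 := by
    rintro h0
    simp [h0] at hA
  have hr0 : (r : ℚ_[p]) ≠ 0 := by
    rintro h0
    simp [h0] at hr
  have hsq := Padic.isSquare_mul_add hp (y := (A : ℚ_[p]) * r ^ 2)
    (t := -((A : ℚ_[p]) * r ^ 2 + B * s ^ 2 - 1)) (by rw [norm_neg, norm_mul, norm_pow, hA, hr]; simpa using h)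
  obtain ⟨c, hc⟩ := hsq
  refine ⟨c / (A * r), s, ?_⟩
  field_simp
  linear_combination -hc

theorem Padic.hilbertTrivial_of_norm_eq_one {p : ℕ} [Fact p.Prime] (hp : 2 < p) {A B : ℚ_[p]}
    (hA : ‖A‖ = 1) (hB : ‖B‖ = 1) : HilbertTrivial A B := by
  obtain ⟨A, rfl⟩ : ∃ x : ℤ_[p], (x : ℚ_[p]) = A := ⟨⟨A, hA.le⟩, rfl⟩
  obtain ⟨B, rfl⟩ : ∃ x : ℤ_[p], (x : ℚ_[p]) = B := ⟨⟨B, hB.le⟩, rfl⟩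
  rw [← PadicInt.norm_def] at hA hB
  have key : ∀ {x : ℤ_[p]}, PadicInt.toZMod x ≠ 0 → ‖x‖ = 1 := fun {x} hx ↦
    le_antisymm x.norm_le_one (not_lt.1 fun h ↦ hx (PadicInt.norm_lt_one_iff_toZMod_eq_zero.1 h))
  have key' : ∀ {x : ℤ_[p]}, ‖x‖ = 1 → PadicInt.toZMod x ≠ 0 := fun {x} hx h ↦
    absurd (PadicInt.norm_lt_one_iff_toZMod_eq_zero.2 h) hx.not_lt
  obtain ⟨r, s, h⟩ := ZMod.exists_mul_sq_add_mul_sq hp (key' hA) (key' hB)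
  obtain ⟨r, rfl⟩ := ZMod.ringHom_surjective (PadicInt.toZMod (p := p)) r
  obtain ⟨s, rfl⟩ := ZMod.ringHom_surjective (PadicInt.toZMod (p := p)) s
  by_cases hr : PadicInt.toZMod r = 0
  · have hs : PadicInt.toZMod s ≠ 0 := by
      intro hs
      simp [hr, hs] at h
    refine (hilbertTrivial_of_toZMod hp hB (key hs) (s := r) ?_).symm
    simp only [map_sub, map_add, map_mul, map_pow, map_one]
    linear_combination h
  · refine hilbertTrivial_of_toZMod hp hA (key hr) (s := s) ?_
    simp only [map_sub, map_add, map_mul, map_pow, map_one]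
    linear_combination h

theorem Padic.hilbertTrivial_of_norm_eq_sq {p : ℕ} [Fact p.Prime] (hp : 2 < p) {A B : ℚ_[p]}
    (hA0 : A ≠ 0) (hB0 : B ≠ 0) (hA : ∃ c : ℚ_[p], ‖A‖ = ‖c‖ ^ 2)
    (hB : ∃ c : ℚ_[p], ‖B‖ = ‖c‖ ^ 2) : HilbertTrivial A B := by
  obtain ⟨c, hc⟩ := hA
  obtain ⟨d, hd⟩ := hB
  have hc0 : c ≠ 0 := by
    rintro rfl
    simp_all
  have hd0 : d ≠ 0 := by
    rintro rfl
    simp_all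
  have := Padic.hilbertTrivial_of_norm_eq_one hp (A := A / c ^ 2) (B := B / d ^ 2)
    (by rw [norm_div, norm_pow, hc]; field_simp) (by rw [norm_div, norm_pow, hd]; field_simp)
  rw [← hilbertTrivial_sq_mul_iff hc0 hd0] at this
  rwa [mul_div_cancel₀ _ (pow_ne_zero 2 hc0), mul_div_cancel₀ _ (pow_ne_zero 2 hd0)] at this

theorem Padic.exists_norm_eq_one_not_isSquare {p : ℕ} [Fact p.Prime] (hp : 2 < p) :
    ∃ ε : ℚ_[p], ‖ε‖ = 1 ∧ ¬ IsSquare ε := by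
  obtain ⟨n, hn⟩ := FiniteField.exists_nonsquare (F := ZMod p) (by
    rw [ZMod.ringChar_zmod_n]; exact hp.ne')
  obtain ⟨e, rfl⟩ := ZMod.ringHom_surjective (PadicInt.toZMod (p := p)) n
  refine ⟨e, ?_, ?_⟩
  · rw [← PadicInt.norm_def]
    refine le_antisymm e.norm_le_one (not_lt.1 fun h ↦ hn ?_)
    rw [PadicInt.norm_lt_one_iff_toZMod_eq_zero.1 h]
    exact IsSquare.zero
  · rintro ⟨c, hc⟩
    have hc1 : ‖c‖ ≤ 1 := by
      have h1 : ‖c‖ * ‖c‖ ≤ 1 := by rw [← norm_mul, ← hc]; exact e.norm_le_one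
      nlinarith [norm_nonneg c]
    obtain ⟨c, rfl⟩ : ∃ x : ℤ_[p], (x : ℚ_[p]) = c := ⟨⟨c, hc1⟩, rfl⟩
    refine hn ⟨PadicInt.toZMod c, ?_⟩
    rw [← map_mul]
    congr 1
    apply Subtype.ext
    rw [hc, PadicInt.coe_mul]

theorem Padic.norm_p_ne_sq {p : ℕ} [Fact p.Prime] (c : ℚ_[p]) : ‖(p : ℚ_[p]) * c ^ 2‖ ≠ 1 := by
  intro h
  have hc : c ≠ 0 := by
    rintro rfl
    simp at h
  have hp0 : (p : ℚ_[p]) ≠ 0 := by exact_mod_cast (Fact.out : p.Prime).ne_zero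
  have h0 : (p : ℚ_[p]) * c ^ 2 ≠ 0 := mul_ne_zero hp0 (pow_ne_zero 2 hc)
  rw [Padic.norm_eq_zpow_neg_valuation h0, zpow_eq_one_iff_right₀ (by positivity)
    (by exact_mod_cast (Fact.out : p.Prime).ne_one), Padic.valuation_mul hp0 (pow_ne_zero 2 hc),
    Padic.valuation_pow, Padic.valuation_p] at h
  push_cast at h
  omega

theorem Padic.not_hilbertTrivial_p_mul {p : ℕ} [Fact p.Prime] (hp : 2 < p)
    (hneg : IsSquare (-1 : ℚ_[p])) {ε : ℚ_[p]} (hε : ‖ε‖ = 1) (hns : ¬ IsSquare ε) :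
    ¬ HilbertTrivial (p : ℚ_[p]) (ε * p) := by
  rintro ⟨r, s, h⟩
  have hN : (p : ℚ_[p]) * (r ^ 2 + ε * s ^ 2) = 1 := by rw [← h]; ring
  rcases lt_or_ge ‖r ^ 2 + ε * s ^ 2‖ ‖r ^ 2‖ with hlt | hge
  · have hr : r ≠ 0 := by
      rintro rfl
      exact absurd hlt (by simp; positivity)
    have hs : s ≠ 0 := by
      rintro rfl
      simp at hlt
    have h1 := Padic.isSquare_mul_add hp (y := -r ^ 2) (t := r ^ 2 + ε * s ^ 2)
      (by rwa [norm_neg])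
    apply hns
    apply IsSquare.of_sq_mul (mul_ne_zero hr hs)
    refine (congrArg IsSquare ?_).mp (hneg.mul h1)
    ring
  · rcases hge.eq_or_lt with heq | hgt
    · refine Padic.norm_p_ne_sq r ?_
      rw [norm_mul, heq, ← norm_mul, hN, norm_one]
    · refine Padic.norm_p_ne_sq s ?_
      have : ‖ε * s ^ 2‖ = ‖r ^ 2 + ε * s ^ 2‖ := by
        have := Padic.add_eq_max_of_ne (q := r ^ 2 + ε * s ^ 2) (r := -r ^ 2)
          (by rw [norm_neg]; exact hgt.ne')
        rw [norm_neg, max_eq_left hgt.le] at this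
        rwa [add_neg_eq_iff_eq_add.2 (add_comm _ _)] at this
      rw [norm_mul, hε, one_mul] at this
      rw [norm_mul, this, ← norm_mul, hN, norm_one]

theorem Padic.isSquare_mul_of_norm_sub_lt {p : ℕ} [Fact p.Prime] (hp : 2 < p) {y z : ℚ_[p]}
    (h : ‖z - y‖ < ‖y‖) : IsSquare (y * z) := by
  simpa using Padic.isSquare_mul_add hp h

theorem Padic.norm_eq_of_norm_sub_lt {p : ℕ} [Fact p.Prime] {y z : ℚ_[p]}
    (h : ‖z - y‖ < ‖y‖) : ‖z‖ = ‖y‖ := by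
  have := Padic.add_eq_max_of_ne h.ne
  rwa [sub_add_cancel, max_eq_right h.le] at this

theorem exists_norm_eq_sq_mul {k : Type*} [NormedField k] {A B : k}
    (hA : ∃ c : k, ‖A‖ = ‖c‖ ^ 2) (hB : ∃ c : k, ‖B‖ = ‖c‖ ^ 2) : ∃ c : k, ‖A * B‖ = ‖c‖ ^ 2 := by
  obtain ⟨c, hc⟩ := hA
  obtain ⟨d, hd⟩ := hB
  exact ⟨c * d, by rw [norm_mul, norm_mul, hc, hd, mul_pow]⟩

/-- Square classes of `(x - 1)(x - β)` and `x(x - β)` at a point of a quadratic twist of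
`y² = x(x - 1)(x - β)`, where `f = x(x - 1)(x - β)` represents the twisting class. -/
theorem Padic.square_classes {p : ℕ} [Fact p.Prime] (hp : 2 < p) (hneg : IsSquare (-1 : ℚ_[p]))
    {β x : ℚ_[p]} (hβ : IsSquare β) (hβ1 : ‖β‖ = 1) (hlt : ‖1 - β‖ < 1)
    (hβs : IsSquare (1 - β)) (hx0 : x ≠ 0) (hxβ : x - β ≠ 0) :
    (IsSquare ((x - 1) * (x - β)) ∨
      IsSquare ((x - 1) * (x - β) * (x * (x - 1) * (x - β)))) ∧
    (IsSquare (x * (x - β)) ∨ IsSquare (x * (x - β) * (x * (x - 1) * (x - β))) ∨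
      IsSquare (x * (x - 1) * (x - β)) ∨
      ((∃ c : ℚ_[p], ‖x * (x - β)‖ = ‖c‖ ^ 2) ∧
        ∃ c : ℚ_[p], ‖x * (x - 1) * (x - β)‖ = ‖c‖ ^ 2)) := by
  have hC : IsSquare (x - 1) → IsSquare (x * (x - β) * (x * (x - 1) * (x - β))) := fun h ↦ by
    have := (IsSquare.sq (x * (x - β))).mul h
    rwa [show (x * (x - β)) ^ 2 * (x - 1) = x * (x - β) * (x * (x - 1) * (x - β)) by ring] at this
  rcases lt_trichotomy ‖x‖ 1 with hx | hx | hx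
  · have h1 : IsSquare (x - 1) := by
      have := Padic.isSquare_mul_of_norm_sub_lt hp (y := -1) (z := x - 1) (by simpa using hx)
      simpa using hneg.mul this
    have h2 : IsSquare (x - β) := by
      have := Padic.isSquare_mul_of_norm_sub_lt hp (y := -β) (z := x - β) (by simpa [hβ1] using hx)
      have hβ0 : β ≠ 0 := by
        rintro rfl
        simp at hβ1
      apply IsSquare.of_sq_mul hβ0
      refine (congrArg IsSquare ?_).mp ((hneg.mul hβ).mul this)
      ring
    exact ⟨.inl (h1.mul h2), .inr (.inl (hC h1))⟩
  · rcases (show ‖x - 1‖ ≤ 1 from (by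
      have := Padic.nonarchimedean x (-1)
      simpa [sub_eq_add_neg, hx] using this)).lt_or_eq with hx1' | hx1'
    · have hxs : IsSquare x := by
        simpa using Padic.isSquare_mul_of_norm_sub_lt hp (y := 1) (z := x) (by simpa using hx1')
      refine ⟨.inr ?_, ?_⟩
      · refine (congrArg IsSquare ?_).mp ((IsSquare.sq ((x - 1) * (x - β))).mul hxs)
        ring
      rcases lt_trichotomy ‖x - 1‖ ‖1 - β‖ with h | h | h
      · have := Padic.isSquare_mul_of_norm_sub_lt hp (y := 1 - β) (z := x - β) (by simpa using h)
        left
        apply hxs.mul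
        apply IsSquare.of_sq_mul (c := 1 - β) (by
          rintro h0
          simp only [h0, norm_zero] at h
          linarith [norm_nonneg (x - 1)])
        refine (congrArg IsSquare ?_).mp (hβs.mul this)
        ring
      · rcases lt_or_ge ‖x - β‖ ‖1 - β‖ with h' | h'
        · have hs := Padic.isSquare_mul_of_norm_sub_lt hp (y := -(1 - β)) (z := x - 1) (by
            rw [norm_neg]
            simpa using h')
          right; left
          apply hC
          apply IsSquare.of_sq_mul (c := 1 - β) (by
            rintro h0
            simp only [h0, norm_zero] at h'
            linarith [norm_nonneg (x - β)])
          refine (congrArg IsSquare ?_).mp ((hneg.mul hβs).mul hs)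
          ring
        · have h'' : ‖x - β‖ = ‖1 - β‖ := by
            refine le_antisymm ?_ h'
            have := Padic.nonarchimedean (x - 1) (1 - β)
            simpa [h] using this
          obtain ⟨c, hc⟩ := hβs
          have hE : ‖1 - β‖ = ‖c‖ ^ 2 := by rw [hc, norm_mul, sq]
          right; right; right
          refine ⟨⟨c, by rw [norm_mul, hx, h'', hE, one_mul]⟩, c ^ 2, ?_⟩
          rw [norm_mul, norm_mul, hx, h, h'', hE, norm_pow]
          ring
      · have := Padic.isSquare_mul_of_norm_sub_lt hp (y := x - 1) (z := x - β) (by simpa using h)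
        right; right; left
        rw [mul_assoc]
        exact hxs.mul this
    · have hlt' : ‖(x - β) - (x - 1)‖ < ‖x - 1‖ := by
        simpa [hx1'] using hlt
      have h2 := Padic.norm_eq_of_norm_sub_lt hlt'
      refine ⟨.inl (Padic.isSquare_mul_of_norm_sub_lt hp hlt'), .inr (.inr (.inr ?_))⟩
      exact ⟨⟨1, by simp [hx, h2, hx1']⟩, ⟨1, by simp [hx, h2, hx1']⟩⟩
  · have h1 := Padic.isSquare_mul_of_norm_sub_lt hp (y := x) (z := x - 1) (by simpa using hx)
    have h2 := Padic.isSquare_mul_of_norm_sub_lt hp (y := x) (z := x - β) (by simpa [hβ1] using hx)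
    refine ⟨.inl ?_, .inl h2⟩
    apply IsSquare.of_sq_mul hx0
    refine (congrArg IsSquare ?_).mp (h1.mul h2)
    ring

theorem IsSquare.mul_of_mul_mul {k : Type*} [Field k] {A B C : k} (hC : C ≠ 0)
    (h1 : IsSquare (A * C)) (h2 : IsSquare (C * B)) : IsSquare (A * B) := by
  apply IsSquare.of_sq_mul hC
  refine (congrArg IsSquare ?_).mp (h1.mul h2)
  ring

/-- `(x - 1)(x - β)` pairs trivially with both functions attached to the second curve. -/
theorem Padic.hilbertTrivial_of_square_classes {p : ℕ} [Fact p.Prime] (hp : 2 < p)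
    (hneg : IsSquare (-1 : ℚ_[p])) {A C f g : ℚ_[p]} (hA0 : A ≠ 0) (hC0 : C ≠ 0) (hf : f ≠ 0)
    (hg : g ≠ 0) (hfg : IsSquare (f * g)) (hA : IsSquare A ∨ IsSquare (A * f))
    (hC : IsSquare C ∨ IsSquare (C * g) ∨ IsSquare g ∨
      ((∃ c : ℚ_[p], ‖C‖ = ‖c‖ ^ 2) ∧ ∃ c : ℚ_[p], ‖g‖ = ‖c‖ ^ 2)) :
    HilbertTrivial A C := by
  rcases hA with hA | hA
  · exact hilbertTrivial_of_isSquare_left _ hA0 hA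
  have hAg : IsSquare (A * g) := hA.mul_of_mul_mul hf hfg
  rcases hC with hC | hC | hC | ⟨hC, c, hc⟩
  · exact (hilbertTrivial_of_isSquare_left _ hC0 hC).symm
  · rw [mul_comm] at hC
    exact hilbertTrivial_of_isSquare_mul two_ne_zero hneg hA0 hC0 (hAg.mul_of_mul_mul hg hC)
  · refine hilbertTrivial_of_isSquare_left _ hA0 (IsSquare.of_sq_mul hg ?_)
    refine (congrArg IsSquare ?_).mp (hAg.mul hC)
    ring
  · refine Padic.hilbertTrivial_of_norm_eq_sq hp hA0 hC0 ?_ hC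
    obtain ⟨d, hd⟩ := hAg
    have hc0 : c ≠ 0 := by
      rintro rfl
      simp_all
    refine ⟨d / c, ?_⟩
    have := congrArg norm hd
    rw [norm_mul, norm_mul, hc] at this
    have hc' : ‖c‖ ≠ 0 := norm_ne_zero_iff.2 hc0
    rw [norm_div, div_pow, eq_div_iff (pow_ne_zero 2 hc'), this, sq]

theorem Padic.norm_lt_norm_p_of_isSquare {p : ℕ} [Fact p.Prime] {t : ℚ_[p]} (ht : IsSquare t)
    (h1 : ‖t‖ < 1) : ‖t‖ < ‖(p : ℚ_[p])‖ := by
  obtain ⟨c, rfl⟩ := ht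
  have hc : ‖c‖ < 1 := by
    by_contra! h
    rw [norm_mul] at h1
    nlinarith
  have hc' : ‖c‖ ≤ ‖(p : ℚ_[p])‖ := by
    have := (Padic.norm_le_pow_iff_norm_lt_pow_add_one c (-1)).2 (by simpa using hc)
    simpa using this
  have hp1 : ‖(p : ℚ_[p])‖ < 1 := Padic.norm_p_lt_one
  have hp0 : 0 < ‖(p : ℚ_[p])‖ := norm_pos_iff.2 (by exact_mod_cast (Fact.out : p.Prime).ne_zero)
  rw [norm_mul]
  nlinarith [norm_nonneg c]

/-- Near the node, at distance `‖p‖`, the value of `x(x - 1)(x - β)` is a square and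
`x(x - β)` has the square class of `x - 1`. -/
theorem Padic.isSquare_near_node {p : ℕ} [Fact p.Prime] (hp : 2 < p) {β ε : ℚ_[p]}
    (hlt : ‖1 - β‖ < 1) (hβs : IsSquare (1 - β)) (hε : ‖ε‖ = 1) :
    IsSquare ((1 + ε * p) * (ε * p) * (1 + ε * p - β)) ∧
      IsSquare ((ε * p) * ((1 + ε * p) * (1 + ε * p - β))) ∧
      (1 + ε * p) * (ε * p) * (1 + ε * p - β) ≠ 0 := by
  have hn : ‖ε * p‖ = ‖(p : ℚ_[p])‖ := by rw [norm_mul, hε, one_mul]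
  have hp1 : ‖(p : ℚ_[p])‖ < 1 := Padic.norm_p_lt_one
  have hp0 : 0 < ‖(p : ℚ_[p])‖ := norm_pos_iff.2 (by exact_mod_cast (Fact.out : p.Prime).ne_zero)
  have h1 : IsSquare (1 + ε * p) := Padic.isSquare_one_add hp (by rwa [hn])
  have hl : ‖(1 + ε * p - β) - ε * p‖ < ‖ε * p‖ := by
    rw [hn, show (1 + ε * p - β) - ε * p = 1 - β by ring]
    exact Padic.norm_lt_norm_p_of_isSquare hβs hlt
  have h2 := Padic.isSquare_mul_of_norm_sub_lt hp hl
  have h3 := Padic.norm_eq_of_norm_sub_lt hl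
  have h4 : ‖1 + ε * p‖ = 1 := by
    simpa using Padic.norm_eq_of_norm_sub_lt (y := (1 : ℚ_[p])) (z := 1 + ε * p)
      (by simpa [hε] using hp1)
  refine ⟨?_, ?_, ?_⟩
  · rw [mul_assoc]
    exact h1.mul h2
  · refine (congrArg IsSquare ?_).mp (h1.mul h2)
    ring
  · rw [← norm_ne_zero_iff, norm_mul, norm_mul, h3, h4, hn]
    positivity

theorem evMap_stdBasis {k : Type*} [Field k] (a b a' b' x u : k) (i : Fin 4) :
    evMap a b a' b' (stdBasis i) x u = 0 ↔
      HilbertTrivial (symPair a b a' b' x u i).1 (symPair a b a' b' x u i).2 := by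
  classical
  have : Finset.univ.filter (fun j : Fin 4 => stdBasis i j = 1) = {i} := by
    fin_cases i <;> decide
  rw [evMap, this, Finset.sum_singleton]
  split_ifs with h <;> simp [h]

theorem isSquare_SZMatrix {k : Type*} [Field k] {a b a' b' : k}
    (hker : ∀ ε : Fin 4 → ZMod 2, IsKernelVector a b a' b' ε) (i j : Fin 4) :
    IsSquare (SZMatrix a b a' b' i j) := by
  have : Finset.univ.filter (fun l : Fin 4 => stdBasis j l = 1) = {j} := by
    fin_cases j <;> decide
  have h := hker (stdBasis j) i
  rwa [this, Finset.prod_singleton] at h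

theorem Padic.norm_eq_one_of_valuation {p : ℕ} [Fact p.Prime] {a : ℚ_[p]} (ha : a ≠ 0)
    (h : a.valuation = 0) : ‖a‖ = 1 := by
  rw [Padic.norm_eq_zpow_neg_valuation ha, h, neg_zero, zpow_zero]

theorem Padic.norm_lt_one_of_valuation {p : ℕ} [Fact p.Prime] {a : ℚ_[p]} (ha : a ≠ 0)
    (h : 1 ≤ a.valuation) : ‖a‖ < 1 := by
  rw [Padic.norm_eq_zpow_neg_valuation ha]
  exact zpow_lt_one_of_neg₀ (by exact_mod_cast (Fact.out : p.Prime).one_lt) (by omega)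

/-- Properties of the normalized parameter `b / a`. -/
theorem Padic.normalized_parameter {p : ℕ} [Fact p.Prime] {a b : ℚ_[p]} (ha : a ≠ 0)
    (hab : a ≠ b) (hunit : a.valuation = 0) (hred : 1 ≤ (a - b).valuation)
    (h1 : IsSquare (a * b)) (h2 : IsSquare (a * (a - b))) :
    IsSquare (b / a) ∧ ‖b / a‖ = 1 ∧ ‖1 - b / a‖ < 1 ∧ IsSquare (1 - b / a) := by
  have hlt : ‖1 - b / a‖ < 1 := by
    rw [show 1 - b / a = (a - b) / a by field_simp, norm_div,
      Padic.norm_eq_one_of_valuation ha hunit, div_one]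
    exact Padic.norm_lt_one_of_valuation (sub_ne_zero.2 hab) hred
  refine ⟨?_, ?_, hlt, ?_⟩
  · rw [show b / a = a * b / a ^ 2 by field_simp]
    exact h1.div (IsSquare.sq a)
  · simpa using Padic.norm_eq_of_norm_sub_lt (y := 1) (z := b / a)
      (by rwa [norm_sub_rev, norm_one])
  · rw [show 1 - b / a = a * (a - b) / a ^ 2 by field_simp]
    exact h2.div (IsSquare.sq a)

theorem stmt18 (p : ℕ) [Fact p.Prime] (hp : 2 < p) (a b a' b' : ℚ_[p])
    (ha : a ≠ 0) (hb : b ≠ 0) (ha' : a' ≠ 0) (hb' : b' ≠ 0)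
    (haZ : 0 ≤ a.valuation) (hbZ : 0 ≤ b.valuation)
    (haZ' : 0 ≤ a'.valuation) (hbZ' : 0 ≤ b'.valuation)
    (hab : a ≠ b) (hab' : a' ≠ b')
    (hunit : a.valuation = 0) (hred : 1 ≤ (a - b).valuation)
    (hunit' : a'.valuation = 0) (hred' : 1 ≤ (a' - b').valuation)
    (hker : ∀ ε : Fin 4 → ZMod 2, IsKernelVector a b a' b' ε) :
    (∀ x u z : ℚ_[p], z ≠ 0 →
        z ^ 2 = x * (x - a) * (x - b) * (u * (u - a') * (u - b')) →
        evMap a b a' b' (stdBasis 0) x u = 0 ∧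
        evMap a b a' b' (stdBasis 1) x u = 0 ∧
        evMap a b a' b' (stdBasis 2) x u = 0) ∧
    (∃ x₁ u₁ z₁ x₂ u₂ z₂ : ℚ_[p],
      z₁ ≠ 0 ∧ z₁ ^ 2 = x₁ * (x₁ - a) * (x₁ - b) * (u₁ * (u₁ - a') * (u₁ - b')) ∧
      z₂ ≠ 0 ∧ z₂ ^ 2 = x₂ * (x₂ - a) * (x₂ - b) * (u₂ * (u₂ - a') * (u₂ - b')) ∧
      evMap a b a' b' (stdBasis 3) x₁ u₁ ≠ evMap a b a' b' (stdBasis 3) x₂ u₂) := by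
  have hM := isSquare_SZMatrix hker
  have hsab : IsSquare (a * b) := hM 0 1
  have hsab' : IsSquare (a' * b') := hM 0 2
  have hsaa : IsSquare (a * a') := hM 1 2
  have hsn : IsSquare (-(a * a')) := hM 0 3
  have hneg : IsSquare (-1 : ℚ_[p]) := by
    apply IsSquare.of_sq_mul (mul_ne_zero ha ha')
    refine (congrArg IsSquare ?_).mp (hsaa.mul hsn)
    ring
  obtain ⟨β, rfl⟩ : ∃ β, b = a * β := ⟨b / a, by field_simp⟩
  obtain ⟨β', rfl⟩ : ∃ β', b' = a' * β' := ⟨b' / a', by field_simp⟩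
  have hβall := Padic.normalized_parameter ha hab hunit hred hsab (hM 2 3)
  have hβall' := Padic.normalized_parameter ha' hab' hunit' hred' hsab' (hM 1 3)
  rw [mul_div_cancel_left₀ _ ha] at hβall
  rw [mul_div_cancel_left₀ _ ha'] at hβall'
  obtain ⟨hβ, hβ1, hβlt, hβs⟩ := hβall
  obtain ⟨hβ', hβ1', hβlt', hβs'⟩ := hβall'
  simp only [ne_eq, evMap_stdBasis]
  constructor
  · intro x u z hz hzeq
    obtain ⟨X, rfl⟩ : ∃ X, x = a * X := ⟨x / a, by field_simp⟩
    obtain ⟨U, rfl⟩ : ∃ U, u = a' * U := ⟨u / a', by field_simp⟩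
    set f := X * (X - 1) * (X - β) with hf
    set g := U * (U - 1) * (U - β') with hg
    have hzfg : z ^ 2 = (a * a') ^ 2 * (a * a' * (f * g)) := by
      rw [hzeq, hf, hg]
      ring
    have hfg0 : f * g ≠ 0 := by
      intro h
      rw [h] at hzfg
      simp at hzfg
      exact hz hzfg
    have hfg : IsSquare (f * g) := by
      apply IsSquare.of_sq_mul (mul_ne_zero ha ha')
      have : IsSquare (a * a' * (f * g)) :=
        IsSquare.of_sq_mul (mul_ne_zero ha ha') (hzfg ▸ IsSquare.sq z)
      refine (congrArg IsSquare ?_).mp (hsaa.mul this)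
      ring
    have hf0 : f ≠ 0 := left_ne_zero_of_mul hfg0
    have hg0 : g ≠ 0 := right_ne_zero_of_mul hfg0
    have hX0 : X ≠ 0 := left_ne_zero_of_mul (left_ne_zero_of_mul hf0)
    have hX1 : X - 1 ≠ 0 := right_ne_zero_of_mul (left_ne_zero_of_mul hf0)
    have hXβ : X - β ≠ 0 := right_ne_zero_of_mul hf0
    have hU0 : U ≠ 0 := left_ne_zero_of_mul (left_ne_zero_of_mul hg0)
    have hU1 : U - 1 ≠ 0 := right_ne_zero_of_mul (left_ne_zero_of_mul hg0)
    have hUβ : U - β' ≠ 0 := right_ne_zero_of_mul hg0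
    obtain ⟨hA, hC⟩ := Padic.square_classes hp hneg hβ hβ1 hβlt hβs hX0 hXβ
    obtain ⟨hA', hC'⟩ := Padic.square_classes hp hneg hβ' hβ1' hβlt' hβs' hU0 hUβ
    have hA0 := mul_ne_zero hX1 hXβ
    have hA0' := mul_ne_zero hU1 hUβ
    have hgf : IsSquare (g * f) := by rwa [mul_comm]
    have e1 : ∀ (c x β : ℚ_[p]), (c * x - c) * (c * x - c * β) = c ^ 2 * ((x - 1) * (x - β)) :=
      fun c x β ↦ by ring
    have e2 : ∀ (c x β : ℚ_[p]), (c * x) * (c * x - c * β) = c ^ 2 * (x * (x - β)) :=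
      fun c x β ↦ by ring
    refine ⟨?_, ?_, ?_⟩
    · change HilbertTrivial ((a * X - a) * (a * X - a * β))
        ((a' * U - a') * (a' * U - a' * β'))
      rw [e1, e1, hilbertTrivial_sq_mul_iff ha ha']
      exact Padic.hilbertTrivial_of_square_classes hp hneg hA0 hA0' hf0 hg0 hfg hA
        (hA'.imp_right .inl)
    · change HilbertTrivial ((a * X - a) * (a * X - a * β)) ((a' * U) * (a' * U - a' * β'))
      rw [e1, e2, hilbertTrivial_sq_mul_iff ha ha']
      exact Padic.hilbertTrivial_of_square_classes hp hneg hA0 (mul_ne_zero hU0 hUβ) hf0 hg0 hfg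
        hA hC'
    · change HilbertTrivial ((a * X) * (a * X - a * β)) ((a' * U - a') * (a' * U - a' * β'))
      rw [e1, e2, hilbertTrivial_sq_mul_iff ha ha']
      exact (Padic.hilbertTrivial_of_square_classes hp hneg hA0' (mul_ne_zero hX0 hXβ) hg0 hf0 hgf
        hA' hC).symm
  · obtain ⟨ε, hε, hns⟩ := Padic.exists_norm_eq_one_not_isSquare (p := p) hp
    have hp0 : (p : ℚ_[p]) ≠ 0 := by exact_mod_cast (Fact.out : p.Prime).ne_zero
    obtain ⟨v, hv⟩ := hsaa
    have hv0 : v ≠ 0 := by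
      rintro rfl
      simp [ha, ha'] at hv
    have key : ∀ e : ℚ_[p], ‖e‖ = 1 → ∃ z : ℚ_[p], z ≠ 0 ∧
        z ^ 2 = (a * (1 + 1 * p)) * (a * (1 + 1 * p) - a) * (a * (1 + 1 * p) - a * β) *
          ((a' * (1 + e * p)) * (a' * (1 + e * p) - a') * (a' * (1 + e * p) - a' * β')) ∧
        (HilbertTrivial (symPair a (a * β) a' (a' * β') (a * (1 + 1 * p)) (a' * (1 + e * p)) 3).1
          (symPair a (a * β) a' (a' * β') (a * (1 + 1 * p)) (a' * (1 + e * p)) 3).2 ↔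
          HilbertTrivial (p : ℚ_[p]) (e * p)) := by
      intro e he
      obtain ⟨⟨s, hs⟩, ⟨r, hr⟩, hne⟩ := Padic.isSquare_near_node hp (ε := 1) hβlt hβs norm_one
      obtain ⟨⟨s', hs'⟩, ⟨r', hr'⟩, hne'⟩ := Padic.isSquare_near_node hp hβlt' hβs' he
      have hs0 : s ≠ 0 := by
        rintro rfl
        exact hne (by rw [hs, mul_zero])
      have hs0' : s' ≠ 0 := by
        rintro rfl
        exact hne' (by rw [hs', mul_zero])
      have he0 : e ≠ 0 := by
        rintro rfl
        simp at he
      have hr0 : r ≠ 0 := by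
        rintro rfl
        apply hne
        linear_combination hr
      have hr0' : r' ≠ 0 := by
        rintro rfl
        apply hne'
        linear_combination hr'
      refine ⟨v ^ 3 * s * s', by positivity, ?_, ?_⟩
      · have h3 : (v * v) ^ 3 = (a * a') ^ 3 := by rw [hv]
        calc (v ^ 3 * s * s') ^ 2 = (v * v) ^ 3 * (s * s) * (s' * s') := by ring
          _ = _ := by rw [h3, ← hs, ← hs']; ring
      · have hC : a * (1 + 1 * p) * (a * (1 + 1 * p) - a * β) = (a * r / p) ^ 2 * p := by
          field_simp
          linear_combination hr
        have hC' : a' * (1 + e * p) * (a' * (1 + e * p) - a' * β') =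
            (a' * r' / (e * p)) ^ 2 * (e * p) := by
          field_simp
          linear_combination hr'
        change HilbertTrivial (a * (1 + 1 * p) * (a * (1 + 1 * p) - a * β))
          (a' * (1 + e * p) * (a' * (1 + e * p) - a' * β')) ↔ _
        rw [hC, hC', hilbertTrivial_sq_mul_iff (by positivity) (by positivity)]
    obtain ⟨z₁, hz₁, hz₁', h₁⟩ := key 1 norm_one
    obtain ⟨z₂, hz₂, hz₂', h₂⟩ := key ε hε
    refine ⟨_, _, z₁, _, _, z₂, hz₁, hz₁', hz₂, hz₂', fun h ↦ ?_⟩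
    apply Padic.not_hilbertTrivial_p_mul hp hneg hε hns
    rw [← h₂, ← evMap_stdBasis, ← h, evMap_stdBasis, h₁, one_mul]
    exact hilbertTrivial_of_isSquare_mul two_ne_zero hneg hp0 hp0 ⟨_, rfl⟩
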